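/- Fix a coefficient α ≥ 1. In the private-preferences setting with n = 4 agents, no strategyproof mechanism is r-approximate under the maximum cost objective for any r < max{1, α/2}. -/

import Mathlib

open scoped BigOperators

noncomputable section

/-- A location profile of `n` agents on the line. -/
abbrev Loc (n : ℕ) := Fin n → ℝ

/-- A preference profile: `true` means the agent prefers facility `F₁`,
`false` means the agent prefers facility `F₂`. -/
abbrev Pref (n : ℕ) := Fin n → Bool

/-- All agent locations lie in the unit interval `[0,1]`. -/
def validLoc {n : ℕ} (x : Loc n) : Prop := ∀ i, x i ∈ Set.Icc (0:ℝ) 1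

/-- The pair of facility locations lies in `[0,1]²`. -/
def inBox (y : ℝ × ℝ) : Prop := y.1 ∈ Set.Icc (0:ℝ) 1 ∧ y.2 ∈ Set.Icc (0:ℝ) 1

/-- The location of the facility indexed by `b` (`true` = `F₁`, `false` = `F₂`). -/
def facLoc (y : ℝ × ℝ) (b : Bool) : ℝ := if b then y.1 else y.2

/-- Cost of an agent located at `xi` whose preferred facility is `σi`:
`min(|xi − y_{σi}|, α·|xi − y_{3−σi}|)`. -/
def cost (α xi : ℝ) (σi : Bool) (y : ℝ × ℝ) : ℝ :=
  min |xi - facLoc y σi| (α * |xi - facLoc y (!σi)|)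

/-- Utility of an agent located at `xi` whose preferred facility is `σi`:
`max(1 − |xi − y_{σi}|, (1 − |xi − y_{3−σi}|)/α)`. -/
def util (α xi : ℝ) (σi : Bool) (y : ℝ × ℝ) : ℝ :=
  max (1 - |xi - facLoc y σi|) ((1 - |xi - facLoc y (!σi)|) / α)

/-- Total cost. -/
def SC {n : ℕ} (α : ℝ) (x : Loc n) (σ : Pref n) (y : ℝ × ℝ) : ℝ :=
  ∑ i, cost α (x i) (σ i) y

/-- Maximum cost. -/
def BC {n : ℕ} (α : ℝ) (x : Loc n) (σ : Pref n) (y : ℝ × ℝ) : ℝ :=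
  ⨆ i, cost α (x i) (σ i) y

/-- Total utility. -/
def SU {n : ℕ} (α : ℝ) (x : Loc n) (σ : Pref n) (y : ℝ × ℝ) : ℝ :=
  ∑ i, util α (x i) (σ i) y

/-- Minimum utility. -/
def BU {n : ℕ} (α : ℝ) (x : Loc n) (σ : Pref n) (y : ℝ × ℝ) : ℝ :=
  ⨅ i, util α (x i) (σ i) y

/-- Optimal (minimal) total cost over `y ∈ [0,1]²`. -/
def optSC {n : ℕ} (α : ℝ) (x : Loc n) (σ : Pref n) : ℝ :=
  sInf {c | ∃ y, inBox y ∧ c = SC α x σ y}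

/-- Optimal (minimal) maximum cost over `y ∈ [0,1]²`. -/
def optBC {n : ℕ} (α : ℝ) (x : Loc n) (σ : Pref n) : ℝ :=
  sInf {c | ∃ y, inBox y ∧ c = BC α x σ y}

/-- Optimal (maximal) total utility over `y ∈ [0,1]²`. -/
def optSU {n : ℕ} (α : ℝ) (x : Loc n) (σ : Pref n) : ℝ :=
  sSup {c | ∃ y, inBox y ∧ c = SU α x σ y}

/-- Optimal (maximal) minimum utility over `y ∈ [0,1]²`. -/
def optBU {n : ℕ} (α : ℝ) (x : Loc n) (σ : Pref n) : ℝ :=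
  sSup {c | ∃ y, inBox y ∧ c = BU α x σ y}

/-- Strategyproofness in the private-preferences setting (cost version):
no agent can strictly decrease his cost by misreporting his preference. -/
def SPprefCost {n : ℕ} (α : ℝ) (f : Loc n → Pref n → ℝ × ℝ) : Prop :=
  ∀ x : Loc n, validLoc x → ∀ σ : Pref n, ∀ i : Fin n, ∀ b : Bool,
    cost α (x i) (σ i) (f x σ) ≤ cost α (x i) (σ i) (f x (Function.update σ i b))

/-- Strategyproofness in the private-preferences setting (utility version):
no agent can strictly increase his utility by misreporting his preference. -/
def SPprefUtil {n : ℕ} (α : ℝ) (f : Loc n → Pref n → ℝ × ℝ) : Prop :=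
  ∀ x : Loc n, validLoc x → ∀ σ : Pref n, ∀ i : Fin n, ∀ b : Bool,
    util α (x i) (σ i) (f x (Function.update σ i b)) ≤ util α (x i) (σ i) (f x σ)

/-- Group strategyproofness in the private-preferences setting (cost version):
for every joint misreport of preferences, some deviating agent does not
strictly decrease his cost. -/
def GSPprefCost {n : ℕ} (α : ℝ) (f : Loc n → Pref n → ℝ × ℝ) : Prop :=
  ∀ x : Loc n, validLoc x → ∀ σ σ' : Pref n, σ' ≠ σ →
    ∃ i : Fin n, σ' i ≠ σ i ∧
      cost α (x i) (σ i) (f x σ) ≤ cost α (x i) (σ i) (f x σ')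

/-- Group strategyproofness in the private-preferences setting (utility version). -/
def GSPprefUtil {n : ℕ} (α : ℝ) (f : Loc n → Pref n → ℝ × ℝ) : Prop :=
  ∀ x : Loc n, validLoc x → ∀ σ σ' : Pref n, σ' ≠ σ →
    ∃ i : Fin n, σ' i ≠ σ i ∧
      util α (x i) (σ i) (f x σ') ≤ util α (x i) (σ i) (f x σ)

/-- Strategyproofness in the private-locations setting (cost version). -/
def SPlocCost {n : ℕ} (α : ℝ) (f : Loc n → Pref n → ℝ × ℝ) : Prop :=
  ∀ x : Loc n, validLoc x → ∀ σ : Pref n, ∀ i : Fin n, ∀ z ∈ Set.Icc (0:ℝ) 1,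
    cost α (x i) (σ i) (f x σ) ≤ cost α (x i) (σ i) (f (Function.update x i z) σ)

/-- Strategyproofness in the private-locations setting (utility version). -/
def SPlocUtil {n : ℕ} (α : ℝ) (f : Loc n → Pref n → ℝ × ℝ) : Prop :=
  ∀ x : Loc n, validLoc x → ∀ σ : Pref n, ∀ i : Fin n, ∀ z ∈ Set.Icc (0:ℝ) 1,
    util α (x i) (σ i) (f (Function.update x i z) σ) ≤ util α (x i) (σ i) (f x σ)

/-- Group strategyproofness in the private-locations setting (cost version). -/
def GSPlocCost {n : ℕ} (α : ℝ) (f : Loc n → Pref n → ℝ × ℝ) : Prop :=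
  ∀ x : Loc n, validLoc x → ∀ σ : Pref n, ∀ x' : Loc n, validLoc x' → x' ≠ x →
    ∃ i : Fin n, x' i ≠ x i ∧
      cost α (x i) (σ i) (f x σ) ≤ cost α (x i) (σ i) (f x' σ)

/-- Anonymity: the output is invariant under simultaneous permutations of the agents. -/
def Anonymous {n : ℕ} (f : Loc n → Pref n → ℝ × ℝ) : Prop :=
  ∀ (x : Loc n) (σ : Pref n) (π : Equiv.Perm (Fin n)), f (x ∘ π) (σ ∘ π) = f x σ

/-- Mechanism 1: `F₁` at `(lt+lb)/2` and `F₂` at `(rt+rb)/2`, where `lt`,`rt` are the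
extreme agent locations, `cen` their midpoint, `lb` (`rb`) the agent location closest
to `cen` from the left (right). -/
def mech1 {n : ℕ} (x : Loc n) : ℝ × ℝ :=
  ((⨅ i, x i) / 2 + sSup {z | (∃ i, x i = z) ∧ z ≤ ((⨅ i, x i) + (⨆ i, x i)) / 2} / 2,
   (⨆ i, x i) / 2 + sInf {z | (∃ i, x i = z) ∧ ((⨅ i, x i) + (⨆ i, x i)) / 2 ≤ z} / 2)

/-- Mechanism 2: `F₁` at the midpoint of the extreme locations of agents reporting
preference `F₁`, and likewise for `F₂`. -/
def mech2 {n : ℕ} (x : Loc n) (σ : Pref n) : ℝ × ℝ :=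
  ((sInf {z | ∃ i, σ i = true ∧ x i = z} + sSup {z | ∃ i, σ i = true ∧ x i = z}) / 2,
   (sInf {z | ∃ i, σ i = false ∧ x i = z} + sSup {z | ∃ i, σ i = false ∧ x i = z}) / 2)

/-- Mechanism 3: both facilities at `1/2`. -/
def mech3 : ℝ × ℝ := (1/2, 1/2)

/-- Mechanism 4: facilities at the two extreme reported locations. -/
def mech4 {n : ℕ} (x : Loc n) : ℝ × ℝ := (⨅ i, x i, ⨆ i, x i)

end

theorem cost_nonneg {α : ℝ} (hα : 0 ≤ α) (xi : ℝ) (b : Bool) (y : ℝ × ℝ) :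
    0 ≤ cost α xi b y :=
  le_min (abs_nonneg _) (mul_nonneg hα (abs_nonneg _))

theorem cost_le_BC {n : ℕ} (α : ℝ) (x : Loc n) (σ : Pref n) (y : ℝ × ℝ) (i : Fin n) :
    cost α (x i) (σ i) y ≤ BC α x σ y :=
  le_ciSup (f := fun j => cost α (x j) (σ j) y) (Set.finite_range _).bddAbove i

theorem BC_nonneg {n : ℕ} {α : ℝ} (hα : 0 ≤ α) (x : Loc n) (σ : Pref n) (y : ℝ × ℝ) :
    0 ≤ BC α x σ y :=
  Real.iSup_nonneg fun _ => cost_nonneg hα _ _ _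

theorem optBC_nonneg {n : ℕ} {α : ℝ} (hα : 0 ≤ α) (x : Loc n) (σ : Pref n) :
    0 ≤ optBC α x σ := by
  refine Real.sInf_nonneg ?_
  rintro c ⟨y, -, rfl⟩
  exact BC_nonneg hα x σ y

theorem optBC_le {n : ℕ} [Nonempty (Fin n)] {α : ℝ} (hα : 0 ≤ α) {x : Loc n} {σ : Pref n}
    {y : ℝ × ℝ} {U : ℝ} (hy : inBox y) (h : ∀ i, cost α (x i) (σ i) y ≤ U) :
    optBC α x σ ≤ U := by
  have hbdd : BddBelow {c | ∃ y, inBox y ∧ c = BC α x σ y} := by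
    refine ⟨0, ?_⟩
    rintro c ⟨z, -, rfl⟩
    exact BC_nonneg hα x σ z
  exact (csInf_le hbdd ⟨y, hy, rfl⟩).trans (ciSup_le h)

/-- The instance has two pairs of agents at distance `ε = 1 / (4α)`, one at each end of `[0,1]`.
If the agents of the right pair prefer `F₂` and have small cost, then `F₂` is on the right. -/
theorem right_of_cost_lt {α ε : ℝ} {y : ℝ × ℝ} (hα : 1 ≤ α) (hε : α * ε = 1 / 4)
    (hε' : ε ≤ 1 / 4) (h₃ : cost α (1 - ε) false y < 1 / 8) (h₄ : cost α 1 false y < 1 / 8) :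
    5 / 8 < y.2 := by
  simp only [cost, facLoc, min_lt_iff, Bool.not_false, if_true, Bool.false_eq_true,
    if_false] at h₃ h₄
  rcases h₃ with h₃ | h₃
  · linarith [(abs_lt.1 h₃).2]
  · rcases h₄ with h₄ | h₄
    · linarith [(abs_lt.1 h₄).2]
    · nlinarith [neg_abs_le (1 - ε - y.1), le_abs_self (1 - y.1)]

/-- A left agent preferring `F₂` is served by `F₁` when `F₂` is on the right. -/
theorem abs_sub_lt_of_cost_lt {α ε z : ℝ} {y : ℝ × ℝ} (hα : 1 ≤ α) (hε : α * ε = 1 / 4)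
    (hz : z ≤ 1 / 4) (hy : 5 / 8 < y.2) (h : cost α z false y < 1 / 8) :
    |z - y.1| < ε / 2 := by
  simp only [cost, facLoc, min_lt_iff, Bool.not_false, if_true, Bool.false_eq_true,
    if_false] at h
  rcases h with h | h
  · linarith [(abs_lt.1 h).1]
  · nlinarith

/-- A left agent preferring `F₁` with cost below `ε / 2` is served by `F₁` when `F₂` is on the
right. -/
theorem abs_sub_lt_of_cost_true_lt {α ε z : ℝ} {y : ℝ × ℝ} (hα : 1 ≤ α) (hε' : ε ≤ 1 / 4)
    (hz : z ≤ 1 / 4) (hy : 5 / 8 < y.2) (h : cost α z true y < ε / 2) :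
    |z - y.1| < ε / 2 := by
  simp only [cost, facLoc, min_lt_iff, Bool.not_true, if_true, Bool.false_eq_true,
    if_false] at h
  rcases h with h | h
  · exact h
  · nlinarith [neg_abs_le (z - y.2), abs_nonneg (z - y.2)]

/-- The location profile with two pairs of agents at distance `ε`, one at each end of `[0,1]`. -/
def pairLoc (ε : ℝ) : Loc 4 := ![0, ε, 1 - ε, 1]

/-- The left agents prefer `a` and `b`, the right agents prefer `F₂`. -/
def pairPref (a b : Bool) : Pref 4 := ![a, b, false, false]

theorem optBC_pair_le {α ε t : ℝ} (hα : 1 ≤ α) (hε : α * ε = 1 / 4) (hε₀ : 0 < ε)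
    (hε' : ε ≤ 1 / 4) {a b : Bool} (ht : t ∈ Set.Icc (0 : ℝ) ε)
    (ha : (if a then t else α * t) ≤ 1 / (4 * (1 + α)))
    (hb : (if b then ε - t else α * (ε - t)) ≤ 1 / (4 * (1 + α))) :
    optBC α (pairLoc ε) (pairPref a b) ≤ 1 / (4 * (1 + α)) := by
  obtain ⟨h0, h1⟩ := ht
  have hU : ε / 2 ≤ 1 / (4 * (1 + α)) := by
    rw [le_div_iff₀ (by positivity)]
    nlinarith
  refine optBC_le (y := (t, 1 - ε / 2)) (by linarith)
    ⟨⟨h0, by linarith⟩, by constructor <;> dsimp only <;> linarith⟩ ?_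
  intro i
  fin_cases i
  · cases a
    · refine (min_le_right _ _).trans (le_of_eq_of_le ?_ ha)
      simp [pairLoc, facLoc, pairPref, abs_of_nonneg h0]
    · refine (min_le_left _ _).trans (le_of_eq_of_le ?_ ha)
      simp [pairLoc, facLoc, pairPref, abs_of_nonneg h0]
  · cases b
    · refine (min_le_right _ _).trans (le_of_eq_of_le ?_ hb)
      simp [pairLoc, facLoc, pairPref, abs_of_nonneg (sub_nonneg.2 h1)]
    · refine (min_le_left _ _).trans (le_of_eq_of_le ?_ hb)
      simp [pairLoc, facLoc, pairPref, abs_of_nonneg (sub_nonneg.2 h1)]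
  · refine (min_le_left _ _).trans (le_trans ?_ hU)
    simp only [pairLoc, pairPref, facLoc]
    exact abs_le.2 ⟨by simp, by simp; linarith⟩
  · refine (min_le_left _ _).trans (le_trans ?_ hU)
    simp only [pairLoc, pairPref, facLoc]
    exact abs_le.2 ⟨by simp; linarith, by simp⟩

theorem one_add_div_two_le_approx {α r : ℝ} (hα : 1 ≤ α) {f : Loc 4 → Pref 4 → ℝ × ℝ}
    (hSP : SPprefCost α f)
    (happrox : ∀ x : Loc 4, validLoc x → ∀ σ : Pref 4,
      BC α x σ (f x σ) ≤ r * optBC α x σ) :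
    (1 + α) / 2 ≤ r := by
  by_contra! hr
  obtain ⟨ε, hε⟩ : ∃ ε : ℝ, α * ε = 1 / 4 := ⟨1 / 4 / α, by field_simp⟩
  have hε₀ : 0 < ε := by
    by_contra! h
    nlinarith
  have hε' : ε ≤ 1 / 4 := by nlinarith
  have hU : 0 < 1 / (4 * (1 + α)) := by positivity
  have hx : validLoc (pairLoc ε) := by
    intro i
    fin_cases i <;> simp [pairLoc] <;> constructor <;> linarith
  have small : ∀ a b, optBC α (pairLoc ε) (pairPref a b) ≤ 1 / (4 * (1 + α)) →
      ∀ i, cost α (pairLoc ε i) (pairPref a b i) (f (pairLoc ε) (pairPref a b)) < 1 / 8 := by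
    intro a b h i
    have h0 := optBC_nonneg (by linarith : 0 ≤ α) (pairLoc ε) (pairPref a b)
    calc _ ≤ _ := cost_le_BC _ _ _ _ i
      _ ≤ r * optBC α (pairLoc ε) (pairPref a b) := happrox _ hx _
      _ ≤ max r 0 * (1 / (4 * (1 + α))) :=
        mul_le_mul (le_max_left _ _) h h0 (le_max_right _ _)
      _ < (1 + α) / 2 * (1 / (4 * (1 + α))) :=
        mul_lt_mul_of_pos_right (max_lt hr (by linarith)) hU
      _ = 1 / 8 := by field_simp; norm_num
  have e1 : ε / (1 + α) ≤ 1 / (4 * (1 + α)) := by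
    rw [div_le_div_iff₀ (by positivity) (by positivity)]
    nlinarith
  have e2 : α * (ε / (1 + α)) = 1 / (4 * (1 + α)) := by
    rw [← mul_div_assoc, hε, div_div]
  have e3 : ε / (1 + α) + 1 / (4 * (1 + α)) = ε := by
    rw [← e2]
    field_simp
  have e4 : 0 < ε / (1 + α) := by positivity
  have s0 := small true true (optBC_pair_le hα hε hε₀ hε' (t := ε / (1 + α))
    ⟨e4.le, by linarith⟩ (by simpa using e1) (by simp only [if_true]; linarith))
  have s1 := small true false (optBC_pair_le hα hε hε₀ hε' (t := 1 / (4 * (1 + α)))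
    ⟨hU.le, by linarith⟩ (by simp) (by
      rw [if_neg Bool.false_ne_true, show ε - 1 / (4 * (1 + α)) = ε / (1 + α) by linarith, e2]))
  have s2 := small false true (optBC_pair_le hα hε hε₀ hε' (t := ε / (1 + α))
    ⟨e4.le, by linarith⟩ (by rw [if_neg Bool.false_ne_true, e2]) (by
      simp only [if_true]; linarith))
  have r0 := right_of_cost_lt hα hε hε' (s0 2) (s0 3)
  have r1 := right_of_cost_lt hα hε hε' (s1 2) (s1 3)
  have r2 := right_of_cost_lt hα hε hε' (s2 2) (s2 3)
  have t1 : |ε - _| < ε / 2 := abs_sub_lt_of_cost_lt hα hε hε' r1 (s1 1)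
  have t2 : |0 - _| < ε / 2 := abs_sub_lt_of_cost_lt hα hε (by norm_num) r2 (s2 0)
  have u1 : Function.update (pairPref true true) 1 false = pairPref true false := by
    decide
  have u2 : Function.update (pairPref true true) 0 false = pairPref false true := by
    decide
  have p1 := hSP _ hx (pairPref true true) 1 false
  have p2 := hSP _ hx (pairPref true true) 0 false
  rw [u1] at p1
  rw [u2] at p2
  have q1 : |ε - _| < ε / 2 := abs_sub_lt_of_cost_true_lt hα hε' hε' r0
    (p1.trans_lt ((min_le_left _ _).trans_lt t1))
  have q2 : |0 - _| < ε / 2 := abs_sub_lt_of_cost_true_lt hα hε' (by norm_num) r0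
    (p2.trans_lt ((min_le_left _ _).trans_lt t2))
  linarith [(abs_lt.1 q1).2, (abs_lt.1 q2).1]

/-- With private preferences and `n = 4` agents, no strategyproof mechanism has an
approximation ratio less than `max {1, α/2}` under the maximum cost objective. -/
theorem stmt_3 (α : ℝ) (hα : 1 ≤ α) (f : Loc 4 → Pref 4 → ℝ × ℝ)
    (hbox : ∀ x σ, inBox (f x σ)) (hSP : SPprefCost α f) (r : ℝ)
    (happrox : ∀ x : Loc 4, validLoc x → ∀ σ : Pref 4,
      BC α x σ (f x σ) ≤ r * optBC α x σ) :
    max 1 (α / 2) ≤ r := by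
  have h := one_add_div_two_le_approx hα hSP happrox
  exact max_le (by linarith) (by linarith)
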